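/- Let p > 1 and T > 0. Then λ^+_p(-T,T) = λ_{1,p}(-T,T) / 2^p. -/

import Mathlib

open MeasureTheory Filter Set
open scoped Topology RealInnerProductSpace

noncomputable section

/-- Positive part. -/
def ppart (t : ℝ) : ℝ := max t 0
/-- Negative part. -/
def npart (t : ℝ) : ℝ := max (-t) 0

/-- `u ∈ W^{1,p}(α,β)` (continuous representative on `[α,β]`), with weak derivative `u'`. -/
def MemW1pC (p α β : ℝ) (u u' : ℝ → ℝ) : Prop :=
  IntervalIntegrable u' volume α β ∧
  (∀ t ∈ Set.Icc α β, u t = u α + ∫ s in α..t, u' s) ∧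
  IntegrableOn (fun t => |u' t| ^ p) (Set.Ioo α β) volume

/-- `u ∈ W^{1,p}_0(α,β)`, with weak derivative `u'`. -/
def MemW1p0 (p α β : ℝ) (u u' : ℝ → ℝ) : Prop :=
  MemW1pC p α β u u' ∧ u α = 0 ∧ u β = 0

/-- `u ∈ W^{1,p}(α,β)` (interior version: no constraint at endpoints). -/
def MemW1pI (p α β : ℝ) (u u' : ℝ → ℝ) : Prop :=
  IntervalIntegrable u' volume α β ∧
  (∀ s ∈ Set.Ioo α β, ∀ t ∈ Set.Ioo α β, u t = u s + ∫ r in s..t, u' r) ∧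
  IntegrableOn (fun t => |u' t| ^ p) (Set.Ioo α β) volume

/-- `λ_p^H(α,β)` for a one-dimensional anisotropy `H`. -/
def lamH1 (p : ℝ) (H : ℝ → ℝ) (α β : ℝ) : ℝ :=
  sInf { E | ∃ u u', MemW1p0 p α β u u' ∧ (∫ t in Set.Ioo α β, |u t| ^ p) = 1 ∧
    E = ∫ t in Set.Ioo α β, H (u' t) ^ p }

/-- `λ_{1,p}(α,β)`, the principal Dirichlet eigenvalue of the 1d `p`-Laplacian. -/
def lam1 (p α β : ℝ) : ℝ := lamH1 p (fun t => |t|) α β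

/-- `λ_p^{a,b}(α,β)`. -/
def lamAB (p a b α β : ℝ) : ℝ := lamH1 p (fun t => a * ppart t + b * npart t) α β

/-- `λ_p^+(-T,T)`. -/
def lamPlus (p T : ℝ) : ℝ := lamH1 p ppart (-T) T

/-- `φ` is the (normalized positive) principal eigenfunction of the 1d `p`-Laplacian
on `(-T,T)`, with weak derivative `φ'`. -/
def IsPrincipalEigenfunction (p T : ℝ) (φ φ' : ℝ → ℝ) : Prop :=
  MemW1p0 p (-T) T φ φ' ∧ (∀ t ∈ Set.Ioo (-T) T, 0 < φ t) ∧
  (∫ t in Set.Ioo (-T) T, |φ t| ^ p) = 1 ∧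
  (∫ t in Set.Ioo (-T) T, |φ' t| ^ p) = lam1 p (-T) T

/-- The piecewise Sobolev class `W_pw^{1,p,+}(-T,T)`. -/
def MemWpw (p T : ℝ) (u u' : ℝ → ℝ) : Prop :=
  ∃ (m : ℕ) (P : ℕ → ℝ), 0 < m ∧ P 0 = -T ∧ P m = T ∧
    (∀ i < m, P i < P (i + 1)) ∧
    (∀ i < m, MemW1pI p (P i) (P (i + 1)) u u') ∧
    (∃ l₀, Tendsto u (𝓝[>] (-T)) (𝓝 l₀) ∧ l₀ ≤ 0) ∧
    (∃ l₁, Tendsto u (𝓝[<] T) (𝓝 l₁) ∧ 0 ≤ l₁) ∧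
    (∀ i, 0 < i → i < m → ∃ lm lp, Tendsto u (𝓝[<] (P i)) (𝓝 lm) ∧
      Tendsto u (𝓝[>] (P i)) (𝓝 lp) ∧ lp < lm)

/-! ### Two dimensions -/

/-- The Euclidean plane. -/
abbrev V2 := EuclideanSpace ℝ (Fin 2)

/-- The point of `ℝ²` with coordinates `(x, y)`. -/
def mk2 (x y : ℝ) : V2 := (EuclideanSpace.equiv (Fin 2) ℝ).symm ![x, y]

/-- An asymmetric anisotropy: nonnegative, convex and positively 1-homogeneous. -/
def IsAnisotropy (H : V2 → ℝ) : Prop :=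
  (∀ v, 0 ≤ H v) ∧ ConvexOn ℝ Set.univ H ∧ ∀ t : ℝ, 0 < t → ∀ v : V2, H (t • v) = t * H v

/-- A bounded domain of `ℝ²`. -/
def IsBoundedDomain (Ω : Set V2) : Prop :=
  IsOpen Ω ∧ IsConnected Ω ∧ Bornology.IsBounded Ω

/-- Smooth compactly supported test function on `Ω`. -/
def TestFun2 (Ω : Set V2) (φ : V2 → ℝ) : Prop :=
  ContDiff ℝ (⊤ : ℕ∞) φ ∧ HasCompactSupport φ ∧ tsupport φ ⊆ Ω

/-- `u ∈ W^{1,p}_0(Ω)`, with weak gradient `g`: `u` and `g` are `p`-integrable on `Ω`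
and approximable in `W^{1,p}`-norm by smooth functions compactly supported in `Ω`. -/
def MemW1p02 (p : ℝ) (Ω : Set V2) (u : V2 → ℝ) (g : V2 → V2) : Prop :=
  IntegrableOn (fun x => |u x| ^ p) Ω volume ∧
  IntegrableOn (fun x => ‖g x‖ ^ p) Ω volume ∧
  ∃ φ : ℕ → V2 → ℝ, (∀ n, TestFun2 Ω (φ n)) ∧
    Tendsto (fun n => ∫ x in Ω, |u x - φ n x| ^ p) atTop (𝓝 0) ∧
    Tendsto (fun n => ∫ x in Ω, ‖g x - gradient (φ n) x‖ ^ p) atTop (𝓝 0)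

/-- The least anisotropic energy level `λ_p^H(Ω)`. -/
def lamH (p : ℝ) (H : V2 → ℝ) (Ω : Set V2) : ℝ :=
  sInf { E | ∃ u g, MemW1p02 p Ω u g ∧ (∫ x in Ω, |u x| ^ p) = 1 ∧
    E = ∫ x in Ω, H (g x) ^ p }

/-- `λ_p^H(Ω)` is a fundamental frequency of `-Δ_p^H` on `Ω`. -/
def IsFundFreq (p : ℝ) (H : V2 → ℝ) (Ω : Set V2) : Prop :=
  ∃ u g, MemW1p02 p Ω u g ∧ ¬ (∀ᵐ x ∂(volume.restrict Ω), u x = 0) ∧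
    (∀ᵐ x ∂(volume.restrict Ω), DifferentiableAt ℝ H (g x)) ∧
    AEMeasurable (fun x => gradient H (g x)) (volume.restrict Ω) ∧
    ∀ φ gφ, MemW1p02 p Ω φ gφ →
      (∫ x in Ω, H (g x) ^ (p - 1) * ⟪gradient H (g x), gφ x⟫) =
        lamH p H Ω * ∫ x in Ω, |u x| ^ (p - 2) * u x * φ x

/-- The infimum `λ_p^H(Ω)` is attained by a (normalized, hence nonzero) function. -/
def IsAttained (p : ℝ) (H : V2 → ℝ) (Ω : Set V2) : Prop :=
  ∃ u g, MemW1p02 p Ω u g ∧ (∫ x in Ω, |u x| ^ p) = 1 ∧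
    (∫ x in Ω, H (g x) ^ p) = lamH p H Ω

/-- `‖H‖ := max {H v : |v| = 1}`. -/
def normH (H : V2 → ℝ) : ℝ := sSup (H '' Metric.sphere 0 1)

/-- A rotation: a linear isometry with positive determinant. -/
def IsRotation (A : V2 ≃ₗᵢ[ℝ] V2) : Prop :=
  0 < LinearMap.det (A.toLinearEquiv : V2 →ₗ[ℝ] V2)

/-- The kernel of an anisotropy. -/
def kerH (H : V2 → ℝ) : Set V2 := {v | H v = 0}

/-- `S` is a line through the origin. -/
def IsLine (S : Set V2) : Prop := ∃ v : V2, v ≠ 0 ∧ S = {w | ∃ t : ℝ, w = t • v}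

/-- `S` is a closed half-plane bounded by a line through the origin. -/
def IsClosedHalfPlane (S : Set V2) : Prop := ∃ v : V2, v ≠ 0 ∧ S = {w | ⟪v, w⟫ ≤ 0}

/-- Smooth compactly supported test function on an open set `S ⊆ ℝ`. -/
def TestFun1 (S : Set ℝ) (φ : ℝ → ℝ) : Prop :=
  ContDiff ℝ (⊤ : ℕ∞) φ ∧ HasCompactSupport φ ∧ tsupport φ ⊆ S

/-- `v ∈ W^{1,p}_0(S)` for an open set `S ⊆ ℝ`, with weak derivative `v'`. -/
def MemW1p0S (p : ℝ) (S : Set ℝ) (v v' : ℝ → ℝ) : Prop :=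
  IntegrableOn (fun t => |v t| ^ p) S volume ∧
  IntegrableOn (fun t => |v' t| ^ p) S volume ∧
  ∃ φ : ℕ → ℝ → ℝ, (∀ n, TestFun1 S (φ n)) ∧
    Tendsto (fun n => ∫ t in S, |v t - φ n t| ^ p) atTop (𝓝 0) ∧
    Tendsto (fun n => ∫ t in S, |v' t - deriv (φ n) t| ^ p) atTop (𝓝 0)

/-- A bounded domain with Lipschitz (`C^{0,1}`) boundary: near each boundary point, after a
rigid motion, `Ω` is the region above the graph of a Lipschitz function. -/
def IsC01Domain (Ω : Set V2) : Prop :=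
  IsBoundedDomain Ω ∧
  ∀ z ∈ frontier Ω, ∃ (A : V2 ≃ₗᵢ[ℝ] V2) (r K : ℝ) (f : ℝ → ℝ), 0 < r ∧ 0 ≤ K ∧
    LipschitzWith (Real.toNNReal K) f ∧
    ∀ v ∈ Metric.ball z r, (v ∈ Ω ↔ f ((A (v - z)) 0) < (A (v - z)) 1)

/-- The supremal length of a vertical open segment contained in `D`. -/
def vertWidth (D : Set V2) : ℝ :=
  sSup {l : ℝ | ∃ x c : ℝ, ∀ y ∈ Set.Ioo c (c + l), mk2 x y ∈ D}

/-- The width function `L_θ` of `Ω` in direction `θ`. -/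
def widthFn (Ω : Set V2) (θ : ℝ) : ℝ :=
  sSup {l : ℝ | ∃ (v : V2) (t0 : ℝ),
    ∀ t ∈ Set.Ioo t0 (t0 + l), v + t • mk2 (Real.cos θ) (Real.sin θ) ∈ Ω}

/-- The variational `p`-capacity of `K` relative to `B`. -/
def pCap (p : ℝ) (K B : Set V2) : ℝ :=
  sInf { E | ∃ φ : V2 → ℝ, ContDiff ℝ (⊤ : ℕ∞) φ ∧ HasCompactSupport φ ∧ tsupport φ ⊆ B ∧
    (∀ x ∈ K, 1 ≤ φ x) ∧ E = ∫ x, ‖gradient φ x‖ ^ p }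

/-- The Wiener criterion for the `p`-Laplacian at a boundary point `z`:
the Wiener integral diverges. -/
def WienerRegularAt (p : ℝ) (Ω : Set V2) (z : V2) : Prop :=
  ¬ IntegrableOn (fun t =>
      (pCap p (Metric.closedBall z t \ Ω) (Metric.ball z (2 * t)) /
        pCap p (Metric.closedBall z t) (Metric.ball z (2 * t))) ^ (1 / (p - 1)) / t)
    (Set.Ioo (0 : ℝ) 1) volume

/-- The optimal lower spectral constant `Λ^min(Ω)`. -/
def LambdaMin (p : ℝ) (Ω : Set V2) : ℝ :=
  sInf {lam : ℝ | ∃ H : V2 → ℝ, IsAnisotropy H ∧ normH H = 1 ∧ IsFundFreq p H Ω ∧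
    lam = lamH p H Ω}

end

noncomputable section

/-- Two functions glued at `c`. -/
def glue (c : ℝ) (f g : ℝ → ℝ) : ℝ → ℝ := fun t => if t ≤ c then f t else g t

lemma comp_glue (F : ℝ → ℝ) (c : ℝ) (f g : ℝ → ℝ) :
    (fun t => F (glue c f g t)) = glue c (fun t => F (f t)) (fun t => F (g t)) := by
  funext t
  simp only [glue]
  split_ifs <;> rfl

lemma glue_eqOn_left {a x c : ℝ} (hax : a ≤ x) (hxc : x ≤ c) (f g : ℝ → ℝ) :
    EqOn f (glue c f g) (uIoc a x) := by
  intro t ht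
  rw [uIoc_of_le hax] at ht
  simp [glue, ht.2.trans hxc]

lemma glue_eqOn_right {c x y : ℝ} (hcx : c ≤ x) (hxy : x ≤ y) (f g : ℝ → ℝ) :
    EqOn g (glue c f g) (uIoc x y) := by
  intro t ht
  rw [uIoc_of_le hxy] at ht
  simp [glue, hcx.trans_lt ht.1]

lemma intervalIntegral_congr_uIoc {a b : ℝ} {f g : ℝ → ℝ} (h : EqOn f g (uIoc a b)) :
    ∫ t in a..b, f t = ∫ t in a..b, g t :=
  intervalIntegral.integral_congr_ae (Eventually.of_forall fun _ hx => h hx)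

lemma intervalIntegrable_glue {a b c : ℝ} (hac : a ≤ c) (hcb : c ≤ b) {f g : ℝ → ℝ}
    (hf : IntervalIntegrable f volume a c) (hg : IntervalIntegrable g volume c b) :
    IntervalIntegrable (glue c f g) volume a b :=
  (hf.congr (glue_eqOn_left hac le_rfl f g)).trans (hg.congr (glue_eqOn_right le_rfl hcb f g))

lemma integral_glue {a b c : ℝ} (hac : a ≤ c) (hcb : c ≤ b) {f g : ℝ → ℝ}
    (hf : IntervalIntegrable f volume a c) (hg : IntervalIntegrable g volume c b) :
    ∫ t in a..b, glue c f g t = (∫ t in a..c, f t) + ∫ t in c..b, g t := by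
  rw [intervalIntegral_congr_uIoc (glue_eqOn_left hac le_rfl f g),
    intervalIntegral_congr_uIoc (glue_eqOn_right le_rfl hcb f g),
    intervalIntegral.integral_add_adjacent_intervals
      (hf.congr (glue_eqOn_left hac le_rfl f g)) (hg.congr (glue_eqOn_right le_rfl hcb f g))]

lemma setIntegral_Ioo_eq {a b : ℝ} (hab : a ≤ b) (f : ℝ → ℝ) :
    ∫ t in Ioo a b, f t = ∫ t in a..b, f t := by
  rw [intervalIntegral.integral_of_le hab, integral_Ioc_eq_integral_Ioo]

lemma memW1p0_primitive {p a b : ℝ} (hab : a ≤ b) {h : ℝ → ℝ}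
    (hh : IntervalIntegrable h volume a b)
    (hp : IntervalIntegrable (fun t => |h t| ^ p) volume a b) (h0 : ∫ t in a..b, h t = 0) :
    MemW1p0 p a b (fun t => ∫ s in a..t, h s) h := by
  refine ⟨⟨hh, fun t _ => by simp, ?_⟩, by simp, h0⟩
  exact (intervalIntegrable_iff_integrableOn_Ioo_of_le hab).1 hp

lemma lamH1_nonneg (p : ℝ) {H : ℝ → ℝ} (hH : ∀ t, 0 ≤ H t) (a b : ℝ) : 0 ≤ lamH1 p H a b := by
  refine Real.sInf_nonneg ?_
  rintro _ ⟨u, u', -, -, rfl⟩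
  exact integral_nonneg fun t => Real.rpow_nonneg (hH _) _

lemma MemW1p0.const_mul {p a b : ℝ} {u u' : ℝ → ℝ} (hu : MemW1p0 p a b u u') (c : ℝ) :
    MemW1p0 p a b (fun t => c * u t) (fun t => c * u' t) := by
  obtain ⟨⟨h1, h2, h3⟩, h4, h5⟩ := hu
  refine ⟨⟨h1.const_mul c, fun t ht => ?_, ?_⟩, by simp [h4], by simp [h5]⟩
  · dsimp only
    rw [intervalIntegral.integral_const_mul, h2 t ht]; ring
  · refine (h3.const_mul (|c| ^ p)).congr (Eventually.of_forall fun t => ?_)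
    simp only [abs_mul]
    rw [Real.mul_rpow (abs_nonneg _) (abs_nonneg _)]

/-- The variational inequality for functions which are not normalized. -/
lemma lamH1_mul_le {p a b : ℝ} (hp : 0 < p) {H : ℝ → ℝ} (hH : ∀ t, 0 ≤ H t)
    (hom : ∀ c t, 0 < c → H (c * t) = c * H t) {u u' : ℝ → ℝ} (hu : MemW1p0 p a b u u') :
    lamH1 p H a b * ∫ t in Ioo a b, |u t| ^ p ≤ ∫ t in Ioo a b, H (u' t) ^ p := by
  set N := ∫ t in Ioo a b, |u t| ^ p with hN
  have hN0 : 0 ≤ N := integral_nonneg fun t => Real.rpow_nonneg (abs_nonneg _) _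
  rcases hN0.eq_or_lt with h0 | hpos
  · rw [← h0, mul_zero]
    exact integral_nonneg fun t => Real.rpow_nonneg (hH _) _
  have hc : 0 < N ^ (-p⁻¹) := Real.rpow_pos_of_pos hpos _
  have hcp : (N ^ (-p⁻¹)) ^ p = N⁻¹ := by
    rw [← Real.rpow_mul hN0, neg_mul, inv_mul_cancel₀ hp.ne', Real.rpow_neg_one]
  have key : lamH1 p H a b ≤ N⁻¹ * ∫ t in Ioo a b, H (u' t) ^ p := by
    refine csInf_le ⟨0, ?_⟩ ⟨_, _, hu.const_mul (N ^ (-p⁻¹)), ?_, ?_⟩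
    · rintro _ ⟨u, u', -, -, rfl⟩
      exact integral_nonneg fun t => Real.rpow_nonneg (hH _) _
    · simp_rw [abs_mul, Real.mul_rpow (abs_nonneg _) (abs_nonneg _)]
      rw [integral_const_mul, abs_of_pos hc, hcp, ← hN, inv_mul_cancel₀ hpos.ne']
    · simp_rw [hom _ _ hc, Real.mul_rpow hc.le (hH _)]
      rw [integral_const_mul, hcp]
  calc lamH1 p H a b * N ≤ (N⁻¹ * ∫ t in Ioo a b, H (u' t) ^ p) * N := by gcongr
    _ = _ := by field_simp

lemma IntervalIntegrable.rpow_of_le_abs {p a b : ℝ} (hp : 0 ≤ p) {H : ℝ → ℝ} (hHc : Continuous H)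
    (hH : ∀ t, 0 ≤ H t) (hle : ∀ t, H t ≤ |t|) {f : ℝ → ℝ} (hf : IntervalIntegrable f volume a b)
    (hfp : IntervalIntegrable (fun t => |f t| ^ p) volume a b) :
    IntervalIntegrable (fun t => H (f t) ^ p) volume a b := by
  refine hfp.mono_fun' ?_ (Eventually.of_forall fun t => ?_)
  · exact ((hHc.measurable.comp_aemeasurable
      (intervalIntegrable_iff.1 hf).aestronglyMeasurable.aemeasurable).pow_const p).aestronglyMeasurable
  · dsimp only
    rw [Real.norm_of_nonneg (Real.rpow_nonneg (hH _) _)]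
    exact Real.rpow_le_rpow (hH _) (hle _) hp

/-- The variational inequality tested with a function given by its derivative on the two sides of
an interior point. -/
lemma lamH1_mul_le_glue {p a b c : ℝ} (hp : 0 < p) (hac : a ≤ c) (hcb : c ≤ b)
    {H : ℝ → ℝ} (hHc : Continuous H) (hH : ∀ t, 0 ≤ H t) (hle : ∀ t, H t ≤ |t|)
    (hom : ∀ c t, 0 < c → H (c * t) = c * H t) {f g : ℝ → ℝ}
    (hf : IntervalIntegrable f volume a c) (hg : IntervalIntegrable g volume c b)
    (hfp : IntervalIntegrable (fun t => |f t| ^ p) volume a c)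
    (hgp : IntervalIntegrable (fun t => |g t| ^ p) volume c b)
    (h0 : (∫ t in a..c, f t) + ∫ t in c..b, g t = 0) :
    lamH1 p H a b * ((∫ t in a..c, |∫ s in a..t, f s| ^ p) + ∫ t in c..b, |∫ s in t..b, g s| ^ p)
      ≤ (∫ t in a..c, H (f t) ^ p) + ∫ t in c..b, H (g t) ^ p := by
  have hab := hac.trans hcb
  have hh := intervalIntegrable_glue hac hcb hf hg
  have hI := integral_glue hac hcb hf hg
  have hhp : IntervalIntegrable (fun t => |glue c f g t| ^ p) volume a b := by
    rw [comp_glue (fun x => |x| ^ p)]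
    exact intervalIntegrable_glue hac hcb hfp hgp
  have key := lamH1_mul_le hp hH hom (memW1p0_primitive hab hh hhp (hI.trans h0))
  rw [setIntegral_Ioo_eq hab, setIntegral_Ioo_eq hab, comp_glue (fun x => H x ^ p),
    integral_glue hac hcb (hf.rpow_of_le_abs hp.le hHc hH hle hfp)
      (hg.rpow_of_le_abs hp.le hHc hH hle hgp)] at key
  have hcont : ContinuousOn (fun t => |∫ s in a..t, glue c f g s| ^ p) (uIcc a b) :=
    ((intervalIntegral.continuousOn_primitive_interval'
      hh left_mem_uIcc).abs).rpow_const fun _ _ => Or.inr hp.le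
  have hii := hcont.intervalIntegrable (μ := volume)
  have hc' : c ∈ uIcc a b := by rw [uIcc_of_le hab]; exact ⟨hac, hcb⟩
  rw [← intervalIntegral.integral_add_adjacent_intervals
    (hii.mono_set (uIcc_subset_uIcc_left hc')) (hii.mono_set (uIcc_subset_uIcc_right hc'))] at key
  convert key using 3
  · refine intervalIntegral.integral_congr fun t ht => ?_
    rw [uIcc_of_le hac] at ht
    rw [intervalIntegral_congr_uIoc (glue_eqOn_left ht.1 ht.2 f g)]
  · refine intervalIntegral.integral_congr fun t ht => ?_
    rw [uIcc_of_le hcb] at ht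
    have ht' : t ∈ uIcc a b := by rw [uIcc_of_le hab]; exact ⟨hac.trans ht.1, ht.2⟩
    have e := intervalIntegral.integral_add_adjacent_intervals
      (hh.mono_set (uIcc_subset_uIcc_left ht')) (hh.mono_set (uIcc_subset_uIcc_right ht'))
    rw [hI, h0, ← intervalIntegral_congr_uIoc (glue_eqOn_right ht.1 ht.2 f g)] at e
    rw [eq_neg_of_add_eq_zero_left e, abs_neg]

/-- Functions vanishing only at the left endpoint of `(-T, T)`, and even reflection. -/
lemma lam1_mul_le_of_primitive {p T : ℝ} (hp : 0 < p) (hT : 0 < T) {g : ℝ → ℝ}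
    (hg0 : ∀ t, 0 ≤ g t) (hg : Integrable g) (hgp : Integrable fun t => g t ^ p) :
    lam1 p (-T) T * ∫ t in (-T)..T, |∫ s in (-T)..t, g s| ^ p
      ≤ 2 ^ p * ∫ t in (-T)..T, g t ^ p := by
  have comp : ∀ {f : ℝ → ℝ}, Integrable f → Integrable (fun t => f (T + 2 * t)) := fun hf =>
    (hf.comp_add_left T).comp_mul_left' two_ne_zero
  have comp' : ∀ {f : ℝ → ℝ}, Integrable f → Integrable (fun t => f (T - 2 * t)) := fun hf =>
    (hf.comp_sub_left T).comp_mul_left' two_ne_zero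
  have abs_eq : ∀ x, |2 * g x| ^ p = 2 ^ p * g x ^ p := fun x => by
    rw [abs_of_nonneg (mul_nonneg zero_le_two (hg0 x)), Real.mul_rpow zero_le_two (hg0 x)]
  have i1 : ∀ t, ∫ s in (-T)..t, 2 * g (T + 2 * s) = ∫ s in (-T)..(T + 2 * t), g s := fun t => by
    rw [intervalIntegral.integral_const_mul, intervalIntegral.mul_integral_comp_add_mul]
    congr 1; ring
  have i2 : ∀ t, ∫ s in t..T, -(2 * g (T - 2 * s)) = -∫ s in (-T)..(T - 2 * t), g s := fun t => by
    rw [intervalIntegral.integral_neg, intervalIntegral.integral_const_mul,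
      intervalIntegral.mul_integral_comp_sub_mul]
    congr 2; ring
  have key := lamH1_mul_le_glue (a := -T) (b := T) (c := 0) (H := fun t => |t|)
    (f := fun s => 2 * g (T + 2 * s)) (g := fun s => -(2 * g (T - 2 * s)))
    hp (by linarith) hT.le continuous_abs abs_nonneg (fun _ => le_rfl)
    (fun c t hc => by simp only [abs_mul, abs_of_pos hc])
    ((comp hg).const_mul 2).intervalIntegrable ((comp' hg).const_mul 2).neg.intervalIntegrable
    (by simp only [abs_eq]; exact ((comp hgp).const_mul _).intervalIntegrable)
    (by simp only [abs_neg, abs_eq]; exact ((comp' hgp).const_mul _).intervalIntegrable)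
    (by rw [i1, i2]; simp)
  simp only [i1, i2, abs_neg, abs_eq, intervalIntegral.integral_const_mul] at key
  rw [intervalIntegral.integral_comp_add_mul (fun t => |∫ s in (-T)..t, g s| ^ p) two_ne_zero,
    intervalIntegral.integral_comp_sub_mul (fun t => |∫ s in (-T)..t, g s| ^ p) two_ne_zero,
    intervalIntegral.integral_comp_add_mul (fun t => g t ^ p) two_ne_zero,
    intervalIntegral.integral_comp_sub_mul (fun t => g t ^ p) two_ne_zero] at key
  have e1 : T + 2 * -T = -T := by ring
  have e2 : T - 2 * T = -T := by ring
  simp only [e1, e2, mul_zero, add_zero, sub_zero, smul_eq_mul] at key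
  unfold lam1
  linarith

lemma ppart_nonneg (t : ℝ) : 0 ≤ ppart t := le_max_right _ _

lemma ppart_le_abs (t : ℝ) : ppart t ≤ |t| := max_le (le_abs_self t) (abs_nonneg t)

lemma continuous_ppart : Continuous ppart := continuous_id.max continuous_const

lemma ppart_mul (c t : ℝ) (hc : 0 < c) : ppart (c * t) = c * ppart t := by
  simp only [ppart]
  rw [mul_max_of_nonneg _ _ hc.le, mul_zero]

/-- Functions vanishing only at the left endpoint of `(-T, T)` can be cut off near the right
endpoint at no cost for `lamPlus`. -/
lemma lamPlus_mul_le_of_primitive {p T : ℝ} (hp : 0 < p) (hT : 0 < T) {g : ℝ → ℝ}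
    (hg0 : ∀ t, 0 ≤ g t) (hg : Integrable g) (hgp : Integrable fun t => g t ^ p) :
    lamPlus p T * ∫ t in (-T)..T, |∫ s in (-T)..t, g s| ^ p ≤ ∫ t in (-T)..T, g t ^ p := by
  have hw : Continuous fun t => |∫ s in (-T)..t, g s| ^ p :=
    (intervalIntegral.continuous_primitive (fun _ _ => hg.intervalIntegrable) _).abs.rpow_const
      fun _ => Or.inr hp.le
  have hlam : 0 ≤ lamPlus p T := lamH1_nonneg p ppart_nonneg _ _
  have cut : ∀ c ∈ Ioo (-T) T, lamPlus p T * ∫ t in (-T)..c, |∫ s in (-T)..t, g s| ^ p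
      ≤ ∫ t in (-T)..T, g t ^ p := by
    rintro c ⟨hc1, hc2⟩
    set m := ∫ t in (-T)..c, g t with hm
    have hm0 : 0 ≤ m := intervalIntegral.integral_nonneg hc1.le fun t _ => hg0 t
    have hd : 0 < T - c := sub_pos.2 hc2
    have hpp : ppart (-(m / (T - c))) = 0 := max_eq_right (neg_nonpos.2 (by positivity))
    have hpg : ∀ t, ppart (g t) = g t := fun t => max_eq_left (hg0 t)
    have key := lamH1_mul_le_glue (a := -T) (b := T) (c := c) (H := ppart)
      (f := g) (g := fun _ => -(m / (T - c)))
      hp hc1.le hc2.le continuous_ppart ppart_nonneg ppart_le_abs ppart_mul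
      hg.intervalIntegrable intervalIntegrable_const
      (by simp only [abs_of_nonneg (hg0 _)]; exact hgp.intervalIntegrable)
      intervalIntegrable_const
      (by rw [intervalIntegral.integral_const, smul_eq_mul, ← hm]; field_simp; ring)
    simp only [hpp, hpg, Real.zero_rpow hp.ne', intervalIntegral.integral_zero, add_zero] at key
    have hr : 0 ≤ ∫ t in c..T, |∫ _ in t..T, -(m / (T - c))| ^ p :=
      intervalIntegral.integral_nonneg hc2.le fun t _ => Real.rpow_nonneg (abs_nonneg _) _
    calc _ ≤ _ := mul_le_mul_of_nonneg_left (le_add_of_nonneg_right hr) hlam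
      _ ≤ _ := key
      _ ≤ _ := intervalIntegral.integral_mono_interval le_rfl hc1.le hc2.le
        (Eventually.of_forall fun t => Real.rpow_nonneg (hg0 t) _) hgp.intervalIntegrable
  have hcont : Continuous fun c => lamPlus p T * ∫ t in (-T)..c, |∫ s in (-T)..t, g s| ^ p :=
    continuous_const.mul
      (intervalIntegral.continuous_primitive (fun _ _ => hw.intervalIntegrable _ _) _)
  refine le_of_tendsto ((hcont.tendsto T).mono_left (nhdsWithin_le_nhds (s := Iio T))) ?_
  filter_upwards [Ioo_mem_nhdsLT (show -T < T by linarith)] with c hc using cut c hc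

lemma MemW1p0.continuousOn {p a b : ℝ} (hab : a ≤ b) {u u' : ℝ → ℝ} (hu : MemW1p0 p a b u u') :
    ContinuousOn u (Icc a b) := by
  obtain ⟨⟨h1, h2, -⟩, -, -⟩ := hu
  have := intervalIntegral.continuousOn_primitive_interval' h1 left_mem_uIcc
  rw [uIcc_of_le hab] at this
  exact (continuousOn_const.add this).congr h2

lemma MemW1p0.sub_eq_integral {p a b : ℝ} {u u' : ℝ → ℝ} (hu : MemW1p0 p a b u u') {s t : ℝ}
    (hs : s ∈ Icc a b) (ht : t ∈ Icc a b) : u t - u s = ∫ r in s..t, u' r := by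
  obtain ⟨⟨h1, h2, -⟩, -, -⟩ := hu
  have hab := hs.1.trans hs.2
  rw [← uIcc_of_le hab] at hs ht
  have e := intervalIntegral.integral_interval_sub_left
    (h1.mono_set (uIcc_subset_uIcc_left ht)) (h1.mono_set (uIcc_subset_uIcc_left hs))
  rw [uIcc_of_le hab] at hs ht
  rw [h2 t ht, h2 s hs, ← e]; ring

lemma MemW1p0.neg_comp_neg {p T : ℝ} (hT : 0 ≤ T) {u u' : ℝ → ℝ} (hu : MemW1p0 p (-T) T u u') :
    MemW1p0 p (-T) T (fun t => -u (-t)) (fun t => u' (-t)) := by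
  have hTT : -T ≤ T := by linarith
  refine ⟨⟨?_, fun t ht => ?_, ?_⟩, by simp [hu.2.2], by simp [hu.2.1]⟩
  · have := (IntervalIntegrable.iff_comp_neg (by finiteness)).1 hu.1.1
    rw [neg_neg] at this
    exact this.symm
  · have := hu.sub_eq_integral (s := -t) (t := T) ⟨by linarith [ht.2], by linarith [ht.1]⟩
      ⟨hTT, le_rfl⟩
    rw [intervalIntegral.integral_comp_neg, neg_neg, ← this, hu.2.2]
    simp [hu.2.2]
  · have h3 := (intervalIntegrable_iff_integrableOn_Ioo_of_le hTT).2 hu.1.2.2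
    have := (IntervalIntegrable.iff_comp_neg (by finiteness)).1 h3
    rw [neg_neg] at this
    exact (intervalIntegrable_iff_integrableOn_Ioo_of_le hTT).1 this.symm

lemma MemW1p0.intervalIntegrable_rpow {p a b : ℝ} (hp : 0 ≤ p) (hab : a ≤ b) {u u' : ℝ → ℝ}
    (hu : MemW1p0 p a b u u') {F : ℝ → ℝ} (hF : Continuous F) :
    IntervalIntegrable (fun t => F (u t) ^ p) volume a b := by
  refine ContinuousOn.intervalIntegrable ?_
  rw [uIcc_of_le hab]
  exact (hF.comp_continuousOn (hu.continuousOn hab)).rpow_const fun _ _ => Or.inr hp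

lemma MemW1p0.isOpen_pos {p a b : ℝ} {u u' : ℝ → ℝ} (hu : MemW1p0 p a b u u') :
    IsOpen {t | t ∈ Ioo a b ∧ 0 < u t} := by
  rcases le_total a b with hab | hab
  · exact ((hu.continuousOn hab).mono Ioo_subset_Icc_self).isOpen_inter_preimage isOpen_Ioo isOpen_Ioi
  · simp [Ioo_eq_empty hab.not_gt]

lemma integrable_indicator_rpow {p a b : ℝ} (hp : 0 < p) (hab : a ≤ b) {S : Set ℝ}
    (hS : MeasurableSet S) (hSab : S ⊆ Ioo a b) {H : ℝ → ℝ} (hHc : Continuous H)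
    (hH : ∀ t, 0 ≤ H t) (hle : ∀ t, H t ≤ |t|) {f : ℝ → ℝ} (hf : IntervalIntegrable f volume a b)
    (hfp : IntegrableOn (fun t => |f t| ^ p) (Ioo a b)) :
    Integrable (S.indicator fun t => H (f t)) ∧
      Integrable (fun t => S.indicator (fun t => H (f t)) t ^ p) := by
  have e : (fun t => S.indicator (fun t => H (f t)) t ^ p) =
      S.indicator (fun t => H (f t) ^ p) := by
    funext t
    by_cases ht : t ∈ S <;> simp [ht, Real.zero_rpow hp.ne']
  rw [e, integrable_indicator_iff hS, integrable_indicator_iff hS]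
  constructor
  · have := IntervalIntegrable.rpow_of_le_abs zero_le_one hHc hH hle hf (by simpa using hf.abs)
    simp only [Real.rpow_one] at this
    exact ((intervalIntegrable_iff_integrableOn_Ioo_of_le hab).1 this).mono_set hSab
  · have := IntervalIntegrable.rpow_of_le_abs hp.le hHc hH hle hf
      ((intervalIntegrable_iff_integrableOn_Ioo_of_le hab).2 hfp)
    exact ((intervalIntegrable_iff_integrableOn_Ioo_of_le hab).1 this).mono_set hSab

/-- The positive part of a Sobolev function is controlled by its increase on the set where it is
positive. -/
lemma MemW1p0.ppart_le_integral {p a b : ℝ} {u u' : ℝ → ℝ} (hu : MemW1p0 p a b u u')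
    {g : ℝ → ℝ} (hg0 : ∀ t, 0 ≤ g t) (hg : Integrable g)
    (hug : ∀ t ∈ Ioo a b, 0 < u t → u' t ≤ g t) {t : ℝ} (ht : t ∈ Icc a b) :
    ppart (u t) ≤ ∫ s in a..t, g s := by
  refine max_le ?_ (intervalIntegral.integral_nonneg ht.1 fun s _ => hg0 s)
  have hcont : ContinuousOn u (Icc a t) :=
    (hu.continuousOn (ht.1.trans ht.2)).mono (Icc_subset_Icc_right ht.2)
  have hcomp : IsCompact (Icc a t ∩ u ⁻¹' Iic 0) :=
    isCompact_Icc.of_isClosed_subset (hcont.preimage_isClosed_of_isClosed isClosed_Icc isClosed_Iic)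
      inter_subset_left
  obtain ⟨c, ⟨⟨hac, hct⟩, hc0⟩, hmax⟩ :=
    hcomp.exists_isGreatest ⟨a, ⟨le_rfl, ht.1⟩, hu.2.1.le⟩
  have hc : c ∈ Icc a b := ⟨hac, hct.trans ht.2⟩
  have hii : IntervalIntegrable u' volume c t := hu.1.1.mono_set (by
    rw [uIcc_of_le hct, uIcc_of_le (ht.1.trans ht.2)]; exact Icc_subset_Icc hac ht.2)
  calc u t ≤ u t - u c := by linarith [show u c ≤ 0 from hc0]
    _ = ∫ s in c..t, u' s := hu.sub_eq_integral hc ht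
    _ ≤ ∫ s in c..t, g s := by
      refine intervalIntegral.integral_mono_on_of_le_Ioo hct hii hg.intervalIntegrable
        fun s hs => hug s ⟨hac.trans_lt hs.1, hs.2.trans_le ht.2⟩ ?_
      by_contra h
      exact hs.1.not_ge (hmax ⟨⟨hac.trans hs.1.le, hs.2.le⟩, not_lt.1 h⟩)
    _ ≤ ∫ s in a..t, g s := intervalIntegral.integral_mono_interval hac hct le_rfl
      (Eventually.of_forall hg0) hg.intervalIntegrable

lemma lam1_mul_ppart_le {p T : ℝ} (hp : 0 < p) (hT : 0 < T) {u u' : ℝ → ℝ}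
    (hu : MemW1p0 p (-T) T u u') :
    lam1 p (-T) T * ∫ t in (-T)..T, ppart (u t) ^ p ≤
      2 ^ p * ∫ t in Ioo (-T) T, {t | 0 < u t}.indicator (fun t => ppart (u' t) ^ p) t := by
  have hTT : -T ≤ T := by linarith
  set S := {t | t ∈ Ioo (-T) T ∧ 0 < u t} with hS
  obtain ⟨hg, hgp⟩ := integrable_indicator_rpow hp hTT hu.isOpen_pos.measurableSet
    (fun t ht => ht.1) continuous_ppart ppart_nonneg ppart_le_abs hu.1.1 hu.1.2.2
  rw [← hS] at hg hgp
  have hg0 : ∀ t, 0 ≤ S.indicator (fun t => ppart (u' t)) t :=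
    fun t => indicator_nonneg (fun t _ => ppart_nonneg _) t
  have hw : Continuous fun t => |∫ s in (-T)..t, S.indicator (fun t => ppart (u' t)) s| ^ p :=
    (intervalIntegral.continuous_primitive (fun _ _ => hg.intervalIntegrable) _).abs.rpow_const
      fun _ => Or.inr hp.le
  calc _ ≤ lam1 p (-T) T *
        ∫ t in (-T)..T, |∫ s in (-T)..t, S.indicator (fun t => ppart (u' t)) s| ^ p := by
        refine mul_le_mul_of_nonneg_left ?_ (lamH1_nonneg p abs_nonneg _ _)
        refine intervalIntegral.integral_mono_on hTT
          (hu.intervalIntegrable_rpow hp.le hTT continuous_ppart) (hw.intervalIntegrable _ _)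
          fun t ht => Real.rpow_le_rpow (ppart_nonneg _) ?_ hp.le
        refine (hu.ppart_le_integral hg0 hg (fun s hs hpos => ?_) ht).trans (le_abs_self _)
        rw [indicator_of_mem (show s ∈ S from ⟨hs, hpos⟩)]
        exact le_max_left _ _
    _ ≤ 2 ^ p * ∫ t in (-T)..T, S.indicator (fun t => ppart (u' t)) t ^ p :=
        lam1_mul_le_of_primitive hp hT hg0 hg hgp
    _ = _ := by
        rw [← setIntegral_Ioo_eq hTT]
        congr 1
        refine setIntegral_congr_fun measurableSet_Ioo fun t ht => ?_
        by_cases h : 0 < u t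
        · simp [S, ht.1, ht.2, h]
        · simp [S, h, Real.zero_rpow hp.ne']

lemma lam1_le_of_memW1p0 {p T : ℝ} (hp : 0 < p) (hT : 0 < T) {u u' : ℝ → ℝ}
    (hu : MemW1p0 p (-T) T u u') :
    lam1 p (-T) T * ∫ t in Ioo (-T) T, |u t| ^ p ≤ 2 ^ p * ∫ t in Ioo (-T) T, ppart (u' t) ^ p := by
  have hTT : -T ≤ T := by linarith
  have hv := hu.neg_comp_neg hT.le
  have h1 := lam1_mul_ppart_le hp hT hu
  have h2 := lam1_mul_ppart_le hp hT hv
  have hInt : IntegrableOn (fun t => ppart (u' t) ^ p) (Ioo (-T) T) :=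
    (intervalIntegrable_iff_integrableOn_Ioo_of_le hTT).1
      (hu.1.1.rpow_of_le_abs hp.le continuous_ppart ppart_nonneg ppart_le_abs
        ((intervalIntegrable_iff_integrableOn_Ioo_of_le hTT).2 hu.1.2.2))
  have e1 : ∫ t in (-T)..T, ppart (-u (-t)) ^ p = ∫ t in (-T)..T, ppart (-u t) ^ p := by
    rw [intervalIntegral.integral_comp_neg (fun t => ppart (-u t) ^ p), neg_neg]
  have e2 : ∫ t in Ioo (-T) T, {t | 0 < -u (-t)}.indicator (fun t => ppart (u' (-t)) ^ p) t =
      ∫ t in Ioo (-T) T, {t | u t < 0}.indicator (fun t => ppart (u' t) ^ p) t := by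
    have e : ∀ t, {t | 0 < -u (-t)}.indicator (fun t => ppart (u' (-t)) ^ p) t =
        {t | u t < 0}.indicator (fun t => ppart (u' t) ^ p) (-t) := fun t => by
      simp [indicator_apply]
    simp only [e]
    rw [setIntegral_Ioo_eq hTT, setIntegral_Ioo_eq hTT,
      intervalIntegral.integral_comp_neg
        (fun t => {t | u t < 0}.indicator (fun t => ppart (u' t) ^ p) t), neg_neg]
  rw [e1, e2] at h2
  have e3 : ∫ t in Ioo (-T) T, |u t| ^ p =
      (∫ t in (-T)..T, ppart (u t) ^ p) + ∫ t in (-T)..T, ppart (-u t) ^ p := by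
    rw [setIntegral_Ioo_eq hTT, ← intervalIntegral.integral_add
      (hu.intervalIntegrable_rpow hp.le hTT continuous_ppart)
      (hu.intervalIntegrable_rpow (F := fun x => ppart (-x)) hp.le hTT
        (continuous_ppart.comp continuous_neg))]
    refine intervalIntegral.integral_congr fun t _ => ?_
    rcases le_total 0 (u t) with h | h <;>
      simp [ppart, h, abs_of_nonneg, abs_of_nonpos, Real.zero_rpow hp.ne']
  have hpos : MeasurableSet {t | t ∈ Ioo (-T) T ∧ 0 < u t} := hu.isOpen_pos.measurableSet
  have hneg : MeasurableSet {t | t ∈ Ioo (-T) T ∧ u t < 0} := by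
    have := (hu.const_mul (-1)).isOpen_pos.measurableSet
    simpa using this
  have ind : ∀ s : Set ℝ, MeasurableSet {t | t ∈ Ioo (-T) T ∧ t ∈ s} →
      IntegrableOn (s.indicator fun t => ppart (u' t) ^ p) (Ioo (-T) T) := by
    intro s hs
    refine ((integrable_indicator_iff hs).2 (hInt.mono_set fun t ht => ht.1)).integrableOn.congr_fun
      (fun t ht => ?_) measurableSet_Ioo
    by_cases h : t ∈ s <;> simp [h, ht.1, ht.2]
  have e4 : (∫ t in Ioo (-T) T, {t | 0 < u t}.indicator (fun t => ppart (u' t) ^ p) t) +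
      ∫ t in Ioo (-T) T, {t | u t < 0}.indicator (fun t => ppart (u' t) ^ p) t ≤
      ∫ t in Ioo (-T) T, ppart (u' t) ^ p := by
    rw [← integral_add (ind {t | 0 < u t} hpos) (ind {t | u t < 0} hneg)]
    refine integral_mono ((ind {t | 0 < u t} hpos).add (ind {t | u t < 0} hneg)) hInt fun t => ?_
    have := Real.rpow_nonneg (ppart_nonneg (u' t)) p
    rcases lt_trichotomy (u t) 0 with h | h | h
    · simp [h, h.not_gt]
    · simpa [h] using this
    · simp [h, h.not_gt]
  have h2p : (0 : ℝ) ≤ 2 ^ p := by positivity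
  rw [e3]
  nlinarith [mul_le_mul_of_nonneg_left e4 h2p]

/-- Stretching the left half of `(-T, T)` onto the whole interval. -/
lemma lamPlus_mul_half_le {p T : ℝ} (hp : 0 < p) (hT : 0 < T) {u u' : ℝ → ℝ}
    (hu : MemW1p0 p (-T) T u u') :
    2 ^ p * (lamPlus p T * ∫ t in (-T)..0, |u t| ^ p) ≤ ∫ t in (-T)..0, |u' t| ^ p := by
  have hTT : -T ≤ T := by linarith
  have hT0 : -T ≤ 0 := by linarith
  obtain ⟨hG, hGp⟩ := integrable_indicator_rpow hp hTT measurableSet_Ioo subset_rfl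
    continuous_abs abs_nonneg (fun _ => le_rfl) hu.1.1 hu.1.2.2
  set G := (Ioo (-T) T).indicator fun t => |u' t| with hGdef
  have hG0 : ∀ t, 0 ≤ G t := fun t => indicator_nonneg (fun t _ => abs_nonneg _) t
  have comp : ∀ {f : ℝ → ℝ}, Integrable f → Integrable (fun t => f (-T / 2 + 1 / 2 * t)) :=
    fun hf => (hf.comp_add_left (-T / 2)).comp_mul_left' (by norm_num)
  have hmul : ∀ t, (1 / 2 * G t) ^ p = (1 / 2) ^ p * G t ^ p := fun t =>
    Real.mul_rpow (by norm_num) (hG0 t)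
  have key := lamPlus_mul_le_of_primitive (g := fun t => 1 / 2 * G (-T / 2 + 1 / 2 * t)) hp hT
    (fun t => mul_nonneg (by norm_num) (hG0 _)) ((comp hG).const_mul _)
    (by simp only [hmul]; exact (comp hGp).const_mul _)
  have i1 : ∀ t, ∫ s in (-T)..t, 1 / 2 * G (-T / 2 + 1 / 2 * s) =
      ∫ s in (-T)..(-T / 2 + 1 / 2 * t), G s := fun t => by
    rw [intervalIntegral.integral_const_mul, intervalIntegral.mul_integral_comp_add_mul]
    congr 1; ring
  have half : (1 / 2 : ℝ) ≠ 0 := by norm_num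
  simp only [i1, hmul, intervalIntegral.integral_const_mul] at key
  rw [intervalIntegral.integral_comp_add_mul (fun t => |∫ s in (-T)..t, G s| ^ p) half,
    intervalIntegral.integral_comp_add_mul (fun t => G t ^ p) half] at key
  have e1 : -T / 2 + 1 / 2 * -T = -T := by ring
  have e2 : -T / 2 + 1 / 2 * T = 0 := by ring
  have e3 : (1 / 2 : ℝ)⁻¹ = 2 := by norm_num
  have e4 : (2 : ℝ) ^ p * (1 / 2) ^ p = 1 := by
    rw [← Real.mul_rpow (by norm_num) (by norm_num)]; norm_num
  have e5 : ∫ t in (-T)..0, G t ^ p = ∫ t in (-T)..0, |u' t| ^ p := by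
    rw [← setIntegral_Ioo_eq hT0, ← setIntegral_Ioo_eq hT0]
    refine setIntegral_congr_fun measurableSet_Ioo fun t ht => ?_
    simp [G, ht.1, ht.2.trans hT]
  simp only [e1, e2, e3, e5, smul_eq_mul] at key
  have hle : ∫ t in (-T)..0, |u t| ^ p ≤ ∫ t in (-T)..0, |∫ s in (-T)..t, G s| ^ p := by
    refine intervalIntegral.integral_mono_on hT0 ?_ ?_ fun t ht =>
      Real.rpow_le_rpow (abs_nonneg _) ?_ hp.le
    · refine (hu.intervalIntegrable_rpow hp.le hTT continuous_abs).mono_set ?_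
      rw [uIcc_of_le hT0, uIcc_of_le hTT]
      exact Icc_subset_Icc_right hT.le
    · exact ((intervalIntegral.continuous_primitive
        (fun _ _ => hG.intervalIntegrable) _).abs.rpow_const
        fun _ => Or.inr hp.le).intervalIntegrable _ _
    · have ht' : t ∈ Icc (-T) T := ⟨ht.1, ht.2.trans hT.le⟩
      have h1 := hu.ppart_le_integral hG0 hG (fun s hs _ => by
        rw [hGdef, indicator_of_mem hs]; exact le_abs_self _) ht'
      have h2 := (hu.const_mul (-1)).ppart_le_integral hG0 hG (fun s hs _ => by
        rw [hGdef, indicator_of_mem hs, neg_one_mul]; exact neg_le_abs _) ht'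
      refine (abs_le'.2 ⟨(le_max_left _ _).trans h1, ?_⟩).trans (le_abs_self _)
      rw [← neg_one_mul]
      exact (le_max_left _ _).trans h2
  have hlam : 0 ≤ lamPlus p T := lamH1_nonneg p ppart_nonneg _ _
  have h2p : (0 : ℝ) ≤ 2 ^ p := by positivity
  calc 2 ^ p * (lamPlus p T * ∫ t in (-T)..0, |u t| ^ p)
      ≤ 2 ^ p * (lamPlus p T * ∫ t in (-T)..0, |∫ s in (-T)..t, G s| ^ p) := by gcongr
    _ ≤ 2 ^ p * ((1 / 2) ^ p * ∫ t in (-T)..0, |u' t| ^ p) := by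
        refine mul_le_mul_of_nonneg_left ?_ h2p
        linarith
    _ = _ := by rw [← mul_assoc, e4, one_mul]

lemma lamPlus_le_of_memW1p0 {p T : ℝ} (hp : 0 < p) (hT : 0 < T) {u u' : ℝ → ℝ}
    (hu : MemW1p0 p (-T) T u u') :
    2 ^ p * (lamPlus p T * ∫ t in Ioo (-T) T, |u t| ^ p) ≤ ∫ t in Ioo (-T) T, |u' t| ^ p := by
  have hTT : -T ≤ T := by linarith
  have h1 := lamPlus_mul_half_le hp hT hu
  have h2 := lamPlus_mul_half_le hp hT (hu.neg_comp_neg hT.le)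
  simp only [abs_neg] at h2
  rw [intervalIntegral.integral_comp_neg (fun t => |u t| ^ p),
    intervalIntegral.integral_comp_neg (fun t => |u' t| ^ p), neg_neg, neg_zero] at h2
  have h0 : (0 : ℝ) ∈ uIcc (-T) T := by
    rw [uIcc_of_le hTT]; exact ⟨by linarith, hT.le⟩
  have split : ∀ {f : ℝ → ℝ}, IntervalIntegrable f volume (-T) T →
      ∫ t in Ioo (-T) T, f t = (∫ t in (-T)..0, f t) + ∫ t in (0)..T, f t := fun hf => by
    rw [setIntegral_Ioo_eq hTT, intervalIntegral.integral_add_adjacent_intervals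
      (hf.mono_set (uIcc_subset_uIcc_left h0)) (hf.mono_set (uIcc_subset_uIcc_right h0))]
  rw [split (hu.intervalIntegrable_rpow hp.le hTT continuous_abs),
    split ((intervalIntegrable_iff_integrableOn_Ioo_of_le hTT).2 hu.1.2.2)]
  linarith

theorem lamPlus_eq (p T : ℝ) (hp : 1 < p) (hT : 0 < T) :
    lamPlus p T = lam1 p (-T) T / 2 ^ p := by
  have hp0 : 0 < p := one_pos.trans hp
  have h2p : (0 : ℝ) < 2 ^ p := by positivity
  by_cases hne : ∃ u u', MemW1p0 p (-T) T u u' ∧ (∫ t in Ioo (-T) T, |u t| ^ p) = 1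
  · obtain ⟨v, v', hv, hv1⟩ := hne
    apply le_antisymm
    · rw [le_div_iff₀' h2p]
      refine le_csInf ⟨_, v, v', hv, hv1, rfl⟩ ?_
      rintro _ ⟨u, u', hu, hu1, rfl⟩
      simpa [hu1] using lamPlus_le_of_memW1p0 hp0 hT hu
    · refine le_csInf ⟨_, v, v', hv, hv1, rfl⟩ ?_
      rintro _ ⟨u, u', hu, hu1, rfl⟩
      rw [div_le_iff₀' h2p]
      simpa [hu1] using lam1_le_of_memW1p0 hp0 hT hu
  · have hempty : ∀ H : ℝ → ℝ, lamH1 p H (-T) T = 0 := by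
      intro H
      refine (congrArg sInf (Set.eq_empty_of_forall_notMem ?_)).trans Real.sInf_empty
      rintro _ ⟨u, u', hu, hu1, -⟩
      exact hne ⟨u, u', hu, hu1⟩
    rw [lamPlus, lam1, hempty, hempty, zero_div]

end
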